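/- arXiv:math/0406263 — 3 statements merged into one kernel-verified Lean document; each statement's English description precedes it below -/
import Mathlib

section
/- Let J₀(x) = (1/π)∫₀^π cos(x sin θ) dθ. Then J₀ is twice differentiable on ℝ and satisfies the Bessel differential equation of order zero: for every real x, x·J₀''(x) + J₀'(x) + x·J₀(x) = 0. -/
open Real MeasureTheory

noncomputable def J0 (x : ℝ) : ℝ := (1 / π) * ∫ θ in (0:ℝ)..π, Real.cos (x * Real.sin θ)

theorem hasDerivAt_intervalIntegral_of_bounded_deriv {F F' : ℝ → ℝ → ℝ} {a b C : ℝ}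
    (hF : ∀ x, Continuous (F x)) (hF' : ∀ x, Continuous (F' x))
    (hbound : ∀ x t, ‖F' x t‖ ≤ C) (hderiv : ∀ x t, HasDerivAt (fun y => F y t) (F' x t) x)
    (x : ℝ) : HasDerivAt (fun y => ∫ t in a..b, F y t) (∫ t in a..b, F' x t) x :=
  (intervalIntegral.hasDerivAt_integral_of_dominated_loc_of_deriv_le (bound := fun _ => C)
    Filter.univ_mem (.of_forall fun y => (hF y).aestronglyMeasurable)
    ((hF x).intervalIntegrable a b) (hF' x).aestronglyMeasurable
    (.of_forall fun t _ y _ => hbound y t) intervalIntegrable_const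
    (.of_forall fun t _ y _ => hderiv y t)).2

theorem hasDerivAt_J0 (x : ℝ) :
    HasDerivAt J0 ((1 / π) * ∫ θ in (0:ℝ)..π, -(sin θ * sin (x * sin θ))) x := by
  refine (hasDerivAt_intervalIntegral_of_bounded_deriv (C := 1)
    (F := fun x θ => cos (x * sin θ)) (F' := fun x θ => -(sin θ * sin (x * sin θ)))
    (fun x => by fun_prop) (fun x => by fun_prop) (fun x θ => ?_) (fun x θ => ?_) x).const_mul _
  · rw [norm_neg, norm_mul]
    exact mul_le_one₀ (abs_sin_le_one _) (norm_nonneg _) (abs_sin_le_one _)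
  · exact (hasDerivAt_mul_const (sin θ)).cos.congr_deriv (by ring)

theorem hasDerivAt_deriv_J0 (x : ℝ) :
    HasDerivAt (deriv J0) ((1 / π) * ∫ θ in (0:ℝ)..π, -(sin θ ^ 2 * cos (x * sin θ))) x := by
  rw [funext fun y => (hasDerivAt_J0 y).deriv]
  refine (hasDerivAt_intervalIntegral_of_bounded_deriv (C := 1)
    (F := fun x θ => -(sin θ * sin (x * sin θ))) (F' := fun x θ => -(sin θ ^ 2 * cos (x * sin θ)))
    (fun x => by fun_prop) (fun x => by fun_prop) (fun x θ => ?_) (fun x θ => ?_) x).const_mul _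
  · rw [norm_neg, norm_mul, norm_pow]
    exact mul_le_one₀ (pow_le_one₀ (norm_nonneg _) (abs_sin_le_one _)) (norm_nonneg _)
      (abs_cos_le_one _)
  · exact ((hasDerivAt_mul_const (sin θ)).sin.const_mul (sin θ)).neg.congr_deriv (by ring)

theorem integral_deriv_cos_mul_sin_mul_sin (x : ℝ) :
    ∫ θ in (0:ℝ)..π, (x * (cos θ ^ 2 * cos (x * sin θ)) - sin θ * sin (x * sin θ)) = 0 := by
  rw [intervalIntegral.integral_eq_sub_of_hasDerivAt (f := fun θ => cos θ * sin (x * sin θ))]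
  · simp
  · intro θ _
    exact ((hasDerivAt_cos θ).mul ((hasDerivAt_sin θ).const_mul x).sin).congr_deriv (by ring)
  · exact Continuous.intervalIntegrable (by fun_prop) _ _

theorem J0_bessel_ode :
    Differentiable ℝ J0 ∧ Differentiable ℝ (deriv J0) ∧
      ∀ x : ℝ, x * deriv (deriv J0) x + deriv J0 x + x * J0 x = 0 := by
  refine ⟨fun x => (hasDerivAt_J0 x).differentiableAt,
    fun x => (hasDerivAt_deriv_J0 x).differentiableAt, fun x => ?_⟩
  rw [(hasDerivAt_deriv_J0 x).deriv, (hasDerivAt_J0 x).deriv, J0]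
  have hsum : x * (∫ θ in (0:ℝ)..π, -(sin θ ^ 2 * cos (x * sin θ)))
      + (∫ θ in (0:ℝ)..π, -(sin θ * sin (x * sin θ)))
      + x * (∫ θ in (0:ℝ)..π, cos (x * sin θ)) = 0 := by
    refine Eq.trans ?_ (integral_deriv_cos_mul_sin_mul_sin x)
    rw [← intervalIntegral.integral_const_mul,
      ← intervalIntegral.integral_const_mul, ← intervalIntegral.integral_add,
      ← intervalIntegral.integral_add]
    · refine intervalIntegral.integral_congr fun θ _ => ?_
      rw [cos_sq']
      ring
    all_goals exact Continuous.intervalIntegrable (by fun_prop) _ _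
  linear_combination (1 / π) * hsum
end

section
/- Let J₀, J₁ be the Bessel functions of the first kind of orders 0 and 1 (defined by Jₙ(x) = (1/π)∫₀^π cos(nθ − x sin θ) dθ), let H₀, H₁ be the Struve functions of orders 0 and 1, and let D(x) = H₀(x)·J₁(x) − H₁(x)·J₀(x). Then for every real x ≥ 0, ∫₀^x t·J₁(t) dt = (π x/2)·D(x). -/
open Real MeasureTheory

noncomputable def J1 (x : ℝ) : ℝ := (1 / π) * ∫ θ in (0:ℝ)..π, Real.cos (θ - x * Real.sin θ)

noncomputable def H0 (x : ℝ) : ℝ :=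
  (2 / π) * ∫ θ in (0:ℝ)..(π / 2), Real.sin (x * Real.cos θ)

noncomputable def H1 (x : ℝ) : ℝ :=
  (2 * x / π) * ∫ θ in (0:ℝ)..(π / 2), Real.sin (x * Real.cos θ) * Real.sin θ ^ 2

noncomputable def D (x : ℝ) : ℝ := H0 x * J1 x - H1 x * J0 x

/-- Differentiation under the integral sign for `x ↦ ∫ g θ * φ (x * h θ)`. -/
lemma hasDerivAt_integral_mul_comp {φ φ' g h : ℝ → ℝ} (hφ : ∀ y, HasDerivAt φ (φ' y) y)
    (hφ' : Continuous φ') (hφ'_le : ∀ y, |φ' y| ≤ 1) (hg : Continuous g) (hh : Continuous h)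
    (a b x : ℝ) :
    HasDerivAt (fun x => ∫ θ in a..b, g θ * φ (x * h θ))
      (∫ θ in a..b, g θ * (φ' (x * h θ) * h θ)) x := by
  have hφc : Continuous φ := continuous_iff_continuousAt.2 fun y => (hφ y).continuousAt
  refine (intervalIntegral.hasDerivAt_integral_of_dominated_loc_of_deriv_le
    (F := fun x θ => g θ * φ (x * h θ)) (F' := fun x θ => g θ * (φ' (x * h θ) * h θ))
    (bound := fun θ => |g θ| * |h θ|) Filter.univ_mem ?_ ?_ ?_ ?_ ?_ ?_).2
  · exact .of_forall fun y => Continuous.aestronglyMeasurable (by fun_prop)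
  · exact Continuous.intervalIntegrable (by fun_prop) _ _
  · exact Continuous.aestronglyMeasurable (by fun_prop)
  · refine .of_forall fun θ _ y _ => ?_
    rw [norm_eq_abs, abs_mul, abs_mul]
    exact mul_le_mul_of_nonneg_left
      (mul_le_of_le_one_left (abs_nonneg _) (hφ'_le _)) (abs_nonneg _)
  · exact Continuous.intervalIntegrable (by fun_prop) _ _
  · refine .of_forall fun θ _ y _ => ?_
    exact ((hφ _).comp y (hasDerivAt_mul_const (h θ))).const_mul (g θ)

lemma J1_eq (x : ℝ) : J1 x = (1 / π) * ∫ θ in (0:ℝ)..π, Real.sin θ * Real.sin (x * Real.sin θ) := by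
  have hsymm : ∫ θ in (0:ℝ)..π, Real.cos θ * Real.cos (x * Real.sin θ) = 0 := by
    have h := intervalIntegral.integral_comp_sub_left (a := 0) (b := π)
      (fun θ => Real.cos θ * Real.cos (x * Real.sin θ)) π
    simp only [Real.cos_pi_sub, Real.sin_pi_sub, neg_mul, intervalIntegral.integral_neg,
      sub_self, sub_zero] at h
    linarith
  unfold J1
  simp only [Real.cos_sub]
  rw [intervalIntegral.integral_add (Continuous.intervalIntegrable (by fun_prop) _ _)
    (Continuous.intervalIntegrable (by fun_prop) _ _), hsymm, zero_add]

lemma hasDerivAt_J0_s9 (x : ℝ) : HasDerivAt J0 (-J1 x) x := by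
  have h := (hasDerivAt_integral_mul_comp (g := fun _ => 1) Real.hasDerivAt_cos (by fun_prop)
    (fun y => by simpa using Real.abs_sin_le_one y) continuous_const Real.continuous_sin
    0 π x).const_mul (1 / π)
  simp only [one_mul, neg_mul, intervalIntegral.integral_neg, mul_neg] at h
  rw [J1_eq]
  exact h.congr_deriv (by simp only [mul_comm])

lemma hasDerivAt_mul_J1 (x : ℝ) : HasDerivAt (fun x => x * J1 x) (x * J0 x) x := by
  have h := (hasDerivAt_id x).mul ((hasDerivAt_integral_mul_comp Real.hasDerivAt_sin (by fun_prop)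
    Real.abs_cos_le_one Real.continuous_sin Real.continuous_sin 0 π x).const_mul (1 / π))
  have hparts : ∫ θ in (0:ℝ)..π, (Real.sin θ * Real.sin (x * Real.sin θ)
      + x * (Real.sin θ * (Real.cos (x * Real.sin θ) * Real.sin θ))
      - x * Real.cos (x * Real.sin θ)) = 0 := by
    rw [intervalIntegral.integral_eq_sub_of_hasDerivAt
      (f := fun θ => -(Real.cos θ * Real.sin (x * Real.sin θ)))]
    · simp
    · intro θ _
      have h1 := ((Real.hasDerivAt_cos θ).mul
        ((Real.hasDerivAt_sin _).comp θ ((Real.hasDerivAt_sin θ).const_mul x))).neg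
      refine h1.congr_deriv ?_
      simp only [Function.comp]
      linear_combination (-x * Real.cos (x * Real.sin θ)) * Real.sin_sq_add_cos_sq θ
    · exact Continuous.intervalIntegrable (by fun_prop) _ _
  rw [intervalIntegral.integral_sub (Continuous.intervalIntegrable (by fun_prop) _ _)
    (Continuous.intervalIntegrable (by fun_prop) _ _),
    intervalIntegral.integral_add (Continuous.intervalIntegrable (by fun_prop) _ _)
    (Continuous.intervalIntegrable (by fun_prop) _ _), intervalIntegral.integral_const_mul,
    intervalIntegral.integral_const_mul] at hparts
  simp only [J1_eq]
  refine h.congr_deriv ?_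
  simp only [J0, id]
  linear_combination (1 / π) * hparts

lemma H1_eq (x : ℝ) : H1 x = 2 / π -
    (2 / π) * ∫ θ in (0:ℝ)..(π / 2), Real.cos θ * Real.cos (x * Real.cos θ) := by
  have hparts : ∫ θ in (0:ℝ)..(π / 2), (Real.cos θ * Real.cos (x * Real.cos θ)
      + x * (Real.sin (x * Real.cos θ) * Real.sin θ ^ 2)) = 1 := by
    rw [intervalIntegral.integral_eq_sub_of_hasDerivAt
      (f := fun θ => Real.sin θ * Real.cos (x * Real.cos θ))]
    · simp
    · intro θ _
      refine ((Real.hasDerivAt_sin θ).mul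
        ((Real.hasDerivAt_cos _).comp θ ((Real.hasDerivAt_cos θ).const_mul x))).congr_deriv ?_
      simp only [Function.comp]
      ring
    · exact Continuous.intervalIntegrable (by fun_prop) _ _
  rw [intervalIntegral.integral_add (Continuous.intervalIntegrable (by fun_prop) _ _)
    (Continuous.intervalIntegrable (by fun_prop) _ _), intervalIntegral.integral_const_mul]
    at hparts
  unfold H1
  linear_combination (2 / π) * hparts

lemma hasDerivAt_H0 (x : ℝ) : HasDerivAt H0 (2 / π - H1 x) x := by
  have h := (hasDerivAt_integral_mul_comp (g := fun _ => 1) Real.hasDerivAt_sin (by fun_prop)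
    Real.abs_cos_le_one continuous_const Real.continuous_cos 0 (π / 2) x).const_mul (2 / π)
  simp only [one_mul] at h
  rw [H1_eq, sub_sub_cancel]
  exact h.congr_deriv (by simp only [mul_comm])

lemma hasDerivAt_mul_H1 (x : ℝ) : HasDerivAt (fun x => x * H1 x) (x * H0 x) x := by
  have h := (hasDerivAt_id x).mul (((hasDerivAt_integral_mul_comp Real.hasDerivAt_cos
    (by fun_prop) (fun y => by simpa using Real.abs_sin_le_one y) Real.continuous_cos
    Real.continuous_cos 0 (π / 2) x).const_mul (2 / π)).const_sub (2 / π))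
  have hsplit : ∫ θ in (0:ℝ)..(π / 2), Real.sin (x * Real.cos θ)
      = (∫ θ in (0:ℝ)..(π / 2), Real.sin (x * Real.cos θ) * Real.sin θ ^ 2)
        - ∫ θ in (0:ℝ)..(π / 2), Real.cos θ * (-Real.sin (x * Real.cos θ) * Real.cos θ) := by
    rw [← intervalIntegral.integral_sub (Continuous.intervalIntegrable (by fun_prop) _ _)
      (Continuous.intervalIntegrable (by fun_prop) _ _)]
    refine intervalIntegral.integral_congr fun θ _ => ?_
    linear_combination (-Real.sin (x * Real.cos θ)) * Real.sin_sq_add_cos_sq θ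
  rw [← H1_eq] at h
  simp only [← H1_eq] at h
  refine (h.congr_deriv ?_).congr_of_eventuallyEq (.of_forall fun y => by simp [H1_eq])
  simp only [H0, H1, id]
  linear_combination (-(2 * x / π)) * hsplit

theorem integral_mul_J1 (x : ℝ) (hx : 0 ≤ x) :
    ∫ t in (0:ℝ)..x, t * J1 t = (π * x / 2) * D x := by
  have hderiv (t : ℝ) : HasDerivAt (fun t => (π * t / 2) * D t) (t * J1 t) t := by
    have h := (((hasDerivAt_H0 t).mul (hasDerivAt_mul_J1 t)).sub
      ((hasDerivAt_mul_H1 t).mul (hasDerivAt_J0_s9 t))).const_mul (π / 2)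
    refine (h.congr_deriv ?_).congr_of_eventuallyEq (.of_forall fun y => ?_)
    · field_simp
      ring
    · simp only [D, Pi.mul_apply, Pi.sub_apply]
      ring
  have hcont : Continuous fun t => t * J1 t :=
    continuous_iff_continuousAt.2 fun t => (hasDerivAt_mul_J1 t).continuousAt
  rw [intervalIntegral.integral_eq_sub_of_hasDerivAt (fun t _ => hderiv t)
    (hcont.intervalIntegrable _ _)]
  simp
end

section
/- Let J₁(x) = (1/π)∫₀^π cos(θ − x sin θ) dθ. Let f : (0, ∞) → ℝ be twice continuously differentiable, and let p > 0. Assume that r·f(r), f(r), and r·f'(r) tend to 0 as r → 0⁺ and as r → ∞, and that the functions r ↦ (f''(r) + f'(r)/r − f(r)/r²)·J₁(p r)·r and r ↦ f(r)·J₁(p r)·r are Lebesgue integrable on (0, ∞). Then ∫₀^∞ (f''(r) + f'(r)/r − f(r)/r²)·J₁(p r)·r dr = −p²·∫₀^∞ f(r)·J₁(p r)·r dr. -/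
open Real MeasureTheory Filter Topology

/-- The first derivative of the Bessel function `J1`. -/
noncomputable def J1Deriv (x : ℝ) : ℝ :=
  (1 / π) * ∫ θ in (0:ℝ)..π, Real.sin (θ - x * Real.sin θ) * Real.sin θ

/-- The second derivative of the Bessel function `J1`. -/
noncomputable def J1Deriv2 (x : ℝ) : ℝ :=
  (1 / π) * ∫ θ in (0:ℝ)..π, -(Real.cos (θ - x * Real.sin θ) * Real.sin θ ^ 2)

lemma hasDerivAt_intervalIntegral_of_abs_deriv_le {F F' : ℝ → ℝ → ℝ} {a b C : ℝ}
    (hF : ∀ x, Continuous (F x)) (hF' : ∀ x, Continuous (F' x))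
    (hbound : ∀ x θ, |F' x θ| ≤ C)
    (hderiv : ∀ x θ, HasDerivAt (fun y => F y θ) (F' x θ) x) (x : ℝ) :
    HasDerivAt (fun y => ∫ θ in a..b, F y θ) (∫ θ in a..b, F' x θ) x :=
  (intervalIntegral.hasDerivAt_integral_of_dominated_loc_of_deriv_le (bound := fun _ => C)
    Filter.univ_mem (.of_forall fun y => (hF y).aestronglyMeasurable)
    ((hF x).intervalIntegrable a b) (hF' x).aestronglyMeasurable
    (.of_forall fun θ _ y _ => hbound y θ) intervalIntegrable_const
    (.of_forall fun θ _ y _ => hderiv y θ)).2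

lemma hasDerivAt_besselPhase (θ x : ℝ) :
    HasDerivAt (fun y => θ - y * Real.sin θ) (-Real.sin θ) x := by
  simpa using ((hasDerivAt_id x).mul_const (Real.sin θ)).const_sub θ

lemma hasDerivAt_J1 (x : ℝ) : HasDerivAt J1 (J1Deriv x) x := by
  refine HasDerivAt.const_mul (1 / π) (hasDerivAt_intervalIntegral_of_abs_deriv_le (C := 1)
    (F := fun x θ => Real.cos (θ - x * Real.sin θ))
    (F' := fun x θ => Real.sin (θ - x * Real.sin θ) * Real.sin θ)
    (fun x => by fun_prop) (fun x => by fun_prop) (fun x θ => ?_) (fun x θ => ?_) x)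
  · rw [abs_mul]
    exact mul_le_one₀ (Real.abs_sin_le_one _) (abs_nonneg _) (Real.abs_sin_le_one _)
  · convert (hasDerivAt_besselPhase θ x).cos using 1
    ring

lemma hasDerivAt_J1Deriv (x : ℝ) : HasDerivAt J1Deriv (J1Deriv2 x) x := by
  refine HasDerivAt.const_mul (1 / π) (hasDerivAt_intervalIntegral_of_abs_deriv_le (C := 1)
    (F := fun x θ => Real.sin (θ - x * Real.sin θ) * Real.sin θ)
    (F' := fun x θ => -(Real.cos (θ - x * Real.sin θ) * Real.sin θ ^ 2))
    (fun x => by fun_prop) (fun x => by fun_prop) (fun x θ => ?_) (fun x θ => ?_) x)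
  · rw [abs_neg, abs_mul, abs_pow]
    exact mul_le_one₀ (Real.abs_cos_le_one _) (by positivity)
      (pow_le_one₀ (abs_nonneg _) (Real.abs_sin_le_one _))
  · refine ((hasDerivAt_besselPhase θ x).sin.mul_const (Real.sin θ)).congr_deriv ?_
    ring

lemma abs_one_div_pi_mul_integral_le {g : ℝ → ℝ} (hg : ∀ θ, |g θ| ≤ 1) :
    |(1 / π) * ∫ θ in (0:ℝ)..π, g θ| ≤ 1 := by
  have h := intervalIntegral.norm_integral_le_of_norm_le_const (a := 0) (b := π) (f := g) (C := 1)
    fun θ _ => hg θ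
  rw [sub_zero, abs_of_pos Real.pi_pos, one_mul, Real.norm_eq_abs] at h
  rw [abs_mul, abs_of_pos (by positivity : 0 < 1 / π), one_div, inv_mul_le_iff₀ Real.pi_pos]
  simpa using h

lemma abs_J1_le_one (x : ℝ) : |J1 x| ≤ 1 :=
  abs_one_div_pi_mul_integral_le fun _ => Real.abs_cos_le_one _

lemma abs_J1Deriv_le_one (x : ℝ) : |J1Deriv x| ≤ 1 :=
  abs_one_div_pi_mul_integral_le fun θ => by
    rw [abs_mul]
    exact mul_le_one₀ (Real.abs_sin_le_one _) (abs_nonneg _) (Real.abs_sin_le_one _)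

/-- Bessel's differential equation of order one. -/
lemma J1_bessel_equation (x : ℝ) :
    x ^ 2 * J1Deriv2 x + x * J1Deriv x + (x ^ 2 - 1) * J1 x = 0 := by
  have hd (θ : ℝ) : HasDerivAt
      (fun θ => -(Real.sin (θ - x * Real.sin θ) * (1 + x * Real.cos θ)))
      (x ^ 2 * -(Real.cos (θ - x * Real.sin θ) * Real.sin θ ^ 2)
        + x * (Real.sin (θ - x * Real.sin θ) * Real.sin θ)
        + (x ^ 2 - 1) * Real.cos (θ - x * Real.sin θ)) θ := by
    refine ((((hasDerivAt_id θ).sub ((Real.hasDerivAt_sin θ).const_mul x)).sin).mul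
      (((Real.hasDerivAt_cos θ).const_mul x).const_add 1)).neg.congr_deriv ?_
    simp only [id, Pi.sub_apply]
    linear_combination (x ^ 2 * Real.cos (θ - x * Real.sin θ)) * Real.sin_sq_add_cos_sq θ
  have hI := intervalIntegral.integral_eq_sub_of_hasDerivAt (a := 0) (b := π) (fun θ _ => hd θ)
    (Continuous.intervalIntegrable (by fun_prop) _ _)
  rw [intervalIntegral.integral_add (Continuous.intervalIntegrable (by fun_prop) _ _)
      (Continuous.intervalIntegrable (by fun_prop) _ _),
    intervalIntegral.integral_add (Continuous.intervalIntegrable (by fun_prop) _ _)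
      (Continuous.intervalIntegrable (by fun_prop) _ _)] at hI
  simp only [intervalIntegral.integral_const_mul, Real.sin_pi, Real.sin_zero, mul_zero, sub_zero,
    zero_mul, neg_zero] at hI
  unfold J1 J1Deriv J1Deriv2
  linear_combination (1 / π) * hI

/-- The Wronskian-type expression `r (f' j - f j')` with `j r = J1 (p r)`. -/
noncomputable def hankelWronskian (f : ℝ → ℝ) (p r : ℝ) : ℝ :=
  r * deriv f r * J1 (p * r) - p * (r * f r * J1Deriv (p * r))

lemma hasDerivAt_hankelWronskian {f : ℝ → ℝ} {p r : ℝ} (hr : r ≠ 0)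
    (hf : HasDerivAt f (deriv f r) r) (hf' : HasDerivAt (deriv f) (deriv (deriv f) r) r) :
    HasDerivAt (hankelWronskian f p)
      ((deriv (deriv f) r + deriv f r / r - f r / r ^ 2) * J1 (p * r) * r
        + p ^ 2 * (f r * J1 (p * r) * r)) r := by
  have hp : HasDerivAt (fun r => p * r) p r := by simpa using (hasDerivAt_id r).const_mul p
  refine ((((hasDerivAt_id r).mul hf').mul ((hasDerivAt_J1 (p * r)).comp r hp)).sub
    ((((hasDerivAt_id r).mul hf).mul ((hasDerivAt_J1Deriv (p * r)).comp r hp)).const_mul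
      p)).congr_deriv ?_
  simp only [id, Function.comp_apply, Pi.mul_apply]
  field_simp
  linear_combination (-f r) * J1_bessel_equation (r * p)

lemma tendsto_hankelWronskian {f : ℝ → ℝ} {l : Filter ℝ} (p : ℝ)
    (hf : Tendsto (fun r => r * f r) l (𝓝 0)) (hf' : Tendsto (fun r => r * deriv f r) l (𝓝 0)) :
    Tendsto (hankelWronskian f p) l (𝓝 0) := by
  have h1 := hf'.zero_mul_isBoundedUnder_le (g := fun r => J1 (p * r))
    (isBoundedUnder_of ⟨1, fun r => abs_J1_le_one _⟩)
  have h2 := hf.zero_mul_isBoundedUnder_le (g := fun r => J1Deriv (p * r))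
    (isBoundedUnder_of ⟨1, fun r => abs_J1Deriv_le_one _⟩)
  simpa [← hankelWronskian.eq_1] using h1.sub (h2.const_mul p)

theorem hankel_laplacian_J1 (f : ℝ → ℝ) (p : ℝ) (hp : 0 < p)
    (hf : ContDiffOn ℝ 2 f (Set.Ioi 0))
    (h0 : Tendsto (fun r => r * f r) (𝓝[>] 0) (𝓝 0))
    (h0f : Tendsto f (𝓝[>] 0) (𝓝 0))
    (h0D : Tendsto (fun r => r * deriv f r) (𝓝[>] 0) (𝓝 0))
    (hInf : Tendsto (fun r => r * f r) atTop (𝓝 0))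
    (hInff : Tendsto f atTop (𝓝 0))
    (hInfD : Tendsto (fun r => r * deriv f r) atTop (𝓝 0))
    (hint1 : IntegrableOn
      (fun r => (deriv (deriv f) r + deriv f r / r - f r / r ^ 2) * J1 (p * r) * r)
      (Set.Ioi 0))
    (hint2 : IntegrableOn (fun r => f r * J1 (p * r) * r) (Set.Ioi 0)) :
    ∫ r in Set.Ioi (0:ℝ),
        (deriv (deriv f) r + deriv f r / r - f r / r ^ 2) * J1 (p * r) * r =
      -p ^ 2 * ∫ r in Set.Ioi (0:ℝ), f r * J1 (p * r) * r := by
  have hW : ContinuousWithinAt (hankelWronskian f p) (Set.Ici 0) 0 := by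
    rw [← continuousWithinAt_Ioi_iff_Ici]
    simpa [ContinuousWithinAt, hankelWronskian] using tendsto_hankelWronskian p h0 h0D
  have hd : ∀ r ∈ Set.Ioi (0:ℝ), HasDerivAt (hankelWronskian f p)
      ((deriv (deriv f) r + deriv f r / r - f r / r ^ 2) * J1 (p * r) * r
        + p ^ 2 * (f r * J1 (p * r) * r)) r := by
    intro r hr
    have hnhds := isOpen_Ioi.mem_nhds hr
    have hf' : ContDiffOn ℝ 1 (deriv f) (Set.Ioi 0) :=
      hf.deriv_of_isOpen isOpen_Ioi (by norm_num)
    exact hasDerivAt_hankelWronskian (ne_of_gt hr)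
      ((hf.differentiableOn (by norm_num)).differentiableAt hnhds).hasDerivAt
      ((hf'.differentiableOn (by norm_num)).differentiableAt hnhds).hasDerivAt
  have hI := integral_Ioi_of_hasDerivAt_of_tendsto hW hd (hint1.add (hint2.const_mul (p ^ 2)))
    (tendsto_hankelWronskian p hInf hInfD)
  rw [integral_add hint1 (hint2.const_mul (p ^ 2)), integral_const_mul] at hI
  have hW0 : hankelWronskian f p 0 = 0 := by simp [hankelWronskian]
  linear_combination hI - hW0
end
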